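/- arXiv:1511.05278 — 5 statements merged into one kernel-verified Lean document; each statement's English description precedes it below -/
import Mathlib

section
/- For every ν ∈ {0, 1, ..., 12} and every v ∈ ℂ⁶, √13 · 𝔸₀((S·Tᵛ)·v) = 𝔸₀(v) + ζ^ν·𝔸₁(v) + ζ^{4ν}·𝔸₂(v) + ζ^{9ν}·𝔸₃(v) + ζ^{3ν}·𝔸₄(v) + ζ^{12ν}·𝔸₅(v) + ζ^{10ν}·𝔸₆(v), where (S·Tᵛ)·v denotes the matrix S·Tᵛ applied to the column vector v. -/
noncomputable section

open Complex

def ζ : ℂ := Complex.exp (2 * Real.pi * Complex.I / 13)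

def Tmat : Matrix (Fin 6) (Fin 6) ℂ :=
  Matrix.diagonal ![ζ ^ 7, ζ ^ 11, ζ ^ 8, ζ ^ 6, ζ ^ 2, ζ ^ 5]

def Smat : Matrix (Fin 6) (Fin 6) ℂ :=
  (-(1 / (Real.sqrt 13 : ℂ))) •
    !![ζ ^ 12 - ζ, ζ ^ 10 - ζ ^ 3, ζ ^ 4 - ζ ^ 9, ζ ^ 5 - ζ ^ 8, ζ ^ 2 - ζ ^ 11, ζ ^ 6 - ζ ^ 7;
       ζ ^ 10 - ζ ^ 3, ζ ^ 4 - ζ ^ 9, ζ ^ 12 - ζ, ζ ^ 2 - ζ ^ 11, ζ ^ 6 - ζ ^ 7, ζ ^ 5 - ζ ^ 8;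
       ζ ^ 4 - ζ ^ 9, ζ ^ 12 - ζ, ζ ^ 10 - ζ ^ 3, ζ ^ 6 - ζ ^ 7, ζ ^ 5 - ζ ^ 8, ζ ^ 2 - ζ ^ 11;
       ζ ^ 5 - ζ ^ 8, ζ ^ 2 - ζ ^ 11, ζ ^ 6 - ζ ^ 7, ζ - ζ ^ 12, ζ ^ 3 - ζ ^ 10, ζ ^ 9 - ζ ^ 4;
       ζ ^ 2 - ζ ^ 11, ζ ^ 6 - ζ ^ 7, ζ ^ 5 - ζ ^ 8, ζ ^ 3 - ζ ^ 10, ζ ^ 9 - ζ ^ 4, ζ - ζ ^ 12;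
       ζ ^ 6 - ζ ^ 7, ζ ^ 5 - ζ ^ 8, ζ ^ 2 - ζ ^ 11, ζ ^ 9 - ζ ^ 4, ζ - ζ ^ 12, ζ ^ 3 - ζ ^ 10]

def AA0 (v : Fin 6 → ℂ) : ℂ := v 0 * v 3 + v 1 * v 4 + v 2 * v 5
def AA1 (v : Fin 6 → ℂ) : ℂ := (v 0) ^ 2 - 2 * v 2 * v 3
def AA2 (v : Fin 6 → ℂ) : ℂ := -(v 4) ^ 2 - 2 * v 1 * v 3
def AA3 (v : Fin 6 → ℂ) : ℂ := (v 1) ^ 2 - 2 * v 0 * v 4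
def AA4 (v : Fin 6 → ℂ) : ℂ := (v 2) ^ 2 - 2 * v 1 * v 5
def AA5 (v : Fin 6 → ℂ) : ℂ := -(v 3) ^ 2 - 2 * v 0 * v 5
def AA6 (v : Fin 6 → ℂ) : ℂ := -(v 5) ^ 2 - 2 * v 2 * v 4

theorem zeta_pow_thirteen : ζ ^ 13 = 1 := by
  rw [ζ, ← Complex.exp_nat_mul, ← Complex.exp_two_pi_mul_I]
  congr 1
  push_cast
  ring

theorem zeta_isPrimitiveRoot : IsPrimitiveRoot ζ 13 := by
  simpa [ζ] using Complex.isPrimitiveRoot_exp 13 (by norm_num)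

theorem zeta_cyclotomic :
    1 + ζ + ζ ^ 2 + ζ ^ 3 + ζ ^ 4 + ζ ^ 5 + ζ ^ 6 + ζ ^ 7 + ζ ^ 8 + ζ ^ 9 + ζ ^ 10
      + ζ ^ 11 + ζ ^ 12 = 0 := by
  have h := zeta_isPrimitiveRoot.geom_sum_eq_zero (by norm_num)
  simpa [Finset.sum_range_succ] using h

/-- The quadratic Gauss period `1 + 2 ∑ ζ ^ r` over the nonzero squares `r` modulo 13. -/
def gaussSumThirteen : ℂ :=
  1 + 2 * (ζ + ζ ^ 3 + ζ ^ 4 + ζ ^ 9 + ζ ^ 10 + ζ ^ 12)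

theorem gaussSumThirteen_sq : gaussSumThirteen ^ 2 = 13 := by
  have h := zeta_pow_thirteen
  have hc := zeta_cyclotomic
  unfold gaussSumThirteen
  grind

theorem zeta_pow_add_pow (k l : ℕ) (h : k + l = 13) :
    ζ ^ k + ζ ^ l = ((2 * Real.cos (k * (2 * Real.pi / 13)) : ℝ) : ℂ) := by
  have h1 : ζ ^ k = Complex.exp (((k * (2 * Real.pi / 13) : ℝ) : ℂ) * I) := by
    rw [ζ, ← Complex.exp_nat_mul]
    congr 1
    push_cast
    ring
  have h2 : ζ ^ l = Complex.exp (-((k * (2 * Real.pi / 13) : ℝ) : ℂ) * I) := by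
    rw [neg_mul, Complex.exp_neg, ← h1]
    apply eq_inv_of_mul_eq_one_right
    rw [← pow_add, h, zeta_pow_thirteen]
  rw [h1, h2]
  push_cast
  rw [Complex.two_cos]

theorem gaussSumThirteen_eq_sqrt : gaussSumThirteen = (Real.sqrt 13 : ℂ) := by
  obtain ⟨r, hr0, hr⟩ : ∃ r : ℝ, 0 ≤ r ∧ gaussSumThirteen = r := by
    refine ⟨1 + 2 * (2 * Real.cos ((1 : ℕ) * (2 * Real.pi / 13))
      + 2 * Real.cos ((3 : ℕ) * (2 * Real.pi / 13))
      + 2 * Real.cos ((4 : ℕ) * (2 * Real.pi / 13))), ?_, ?_⟩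
    · have hpi := Real.pi_pos
      have h4 : Real.cos ((4 : ℕ) * (2 * Real.pi / 13)) = -Real.cos (5 * Real.pi / 13) := by
        rw [← Real.cos_pi_sub]
        congr 1
        push_cast
        ring
      have h3 : 0 ≤ Real.cos ((3 : ℕ) * (2 * Real.pi / 13)) := by
        apply Real.cos_nonneg_of_neg_pi_div_two_le_of_le <;> push_cast <;> linarith
      have h1 : Real.cos (5 * Real.pi / 13) ≤ Real.cos ((1 : ℕ) * (2 * Real.pi / 13)) := by
        apply Real.cos_le_cos_of_nonneg_of_le_pi <;> push_cast <;> linarith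
      linarith
    · have e1 := zeta_pow_add_pow 1 12 rfl
      have e3 := zeta_pow_add_pow 3 10 rfl
      have e4 := zeta_pow_add_pow 4 9 rfl
      rw [gaussSumThirteen, Complex.ofReal_add, Complex.ofReal_mul, Complex.ofReal_add,
        Complex.ofReal_add, ← e1, ← e3, ← e4]
      push_cast
      ring
  have hsq : r ^ 2 = 13 := by
    have := gaussSumThirteen_sq
    rw [hr] at this
    exact_mod_cast this
  rw [hr, ← hsq, Real.sqrt_sq hr0]

theorem sqrt_thirteen_mul_AA0_Smat (w : Fin 6 → ℂ) :
    (Real.sqrt 13 : ℂ) * AA0 (Smat.mulVec w) =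
      AA0 w + AA1 w + AA2 w + AA3 w + AA4 w + AA5 w + AA6 w := by
  have h := zeta_pow_thirteen
  have hc := zeta_cyclotomic
  have hg := gaussSumThirteen_sq
  have hg0 : gaussSumThirteen ≠ 0 := by
    intro h0
    norm_num [h0] at hg
  rw [Smat, ← gaussSumThirteen_eq_sqrt, Matrix.smul_mulVec]
  obtain ⟨a, ha⟩ : ∃ a, a = ζ ^ 12 - ζ := ⟨_, rfl⟩
  obtain ⟨b, hb⟩ : ∃ b, b = ζ ^ 10 - ζ ^ 3 := ⟨_, rfl⟩
  obtain ⟨c, hc'⟩ : ∃ c, c = ζ ^ 4 - ζ ^ 9 := ⟨_, rfl⟩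
  obtain ⟨d, hd⟩ : ∃ d, d = ζ ^ 5 - ζ ^ 8 := ⟨_, rfl⟩
  obtain ⟨e, he⟩ : ∃ e, e = ζ ^ 2 - ζ ^ 11 := ⟨_, rfl⟩
  obtain ⟨f, hf⟩ : ∃ f, f = ζ ^ 6 - ζ ^ 7 := ⟨_, rfl⟩
  have p1 : a * d + b * e + c * f = gaussSumThirteen := by
    subst a b c d e f
    unfold gaussSumThirteen
    grind
  have p2 : a * e + b * d + b * f + c * e + c * d + a * f = 0 := by
    subst a b c d e f
    grind
  have p3 : d ^ 2 + e ^ 2 + f ^ 2 - a ^ 2 - b ^ 2 - c ^ 2 = gaussSumThirteen := by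
    subst a b c d e f
    unfold gaussSumThirteen
    grind
  have p4 : d * e + e * f + f * d - a * b - b * c - c * a = -2 * gaussSumThirteen := by
    subst a b c d e f
    unfold gaussSumThirteen
    grind
  rw [show ζ - ζ ^ 12 = -a by rw [ha]; ring, show ζ ^ 3 - ζ ^ 10 = -b by rw [hb]; ring,
    show ζ ^ 9 - ζ ^ 4 = -c by rw [hc']; ring, ← ha, ← hb, ← hc', ← hd, ← he, ← hf]
  simp only [AA0, AA1, AA2, AA3, AA4, AA5, AA6, Pi.smul_apply, smul_eq_mul, Matrix.mulVec,
    dotProduct, Fin.sum_univ_six, Matrix.of_apply, Matrix.cons_val]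
  generalize gaussSumThirteen = g at *
  field_simp
  linear_combination
    (w 0 ^ 2 + w 1 ^ 2 + w 2 ^ 2 - w 3 ^ 2 - w 4 ^ 2 - w 5 ^ 2) * p1
    + (w 0 * w 1 + w 1 * w 2 + w 0 * w 2 - w 3 * w 4 - w 4 * w 5 - w 3 * w 5) * p2
    + (w 0 * w 3 + w 1 * w 4 + w 2 * w 5) * p3
    + (w 0 * w 4 + w 0 * w 5 + w 1 * w 3 + w 1 * w 5 + w 2 * w 3 + w 2 * w 4) * p4

theorem stmt2 (ν : ℕ) (hν : ν ≤ 12) (v : Fin 6 → ℂ) :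
    (Real.sqrt 13 : ℂ) * AA0 (Matrix.mulVec (Smat * Tmat ^ ν) v) =
      AA0 v + ζ ^ ν * AA1 v + ζ ^ (4 * ν) * AA2 v + ζ ^ (9 * ν) * AA3 v
        + ζ ^ (3 * ν) * AA4 v + ζ ^ (12 * ν) * AA5 v + ζ ^ (10 * ν) * AA6 v := by
  rw [← Matrix.mulVec_mulVec, sqrt_thirteen_mul_AA0_Smat]
  have h : (ζ ^ ν) ^ 13 = 1 := by rw [← pow_mul, mul_comm, pow_mul, zeta_pow_thirteen, one_pow]
  have hT (i : Fin 6) : (Tmat ^ ν).mulVec v i = (ζ ^ ν) ^ (![7, 11, 8, 6, 2, 5] i) * v i := by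
    rw [Tmat, Matrix.diagonal_pow, Matrix.mulVec_diagonal, Pi.pow_apply]
    congr 1
    fin_cases i <;> simp [← pow_mul, mul_comm]
  simp only [AA0, AA1, AA2, AA3, AA4, AA5, AA6, hT, Matrix.cons_val, mul_comm _ ν, pow_mul ζ ν]
  generalize ζ ^ ν = x at *
  grind
end
end

section
/- Let H be the 6×6 matrix whose rows are (0,0,0,0,0,1), (0,0,0,1,0,0), (0,0,0,0,1,0), (0,0,−1,0,0,0), (−1,0,0,0,0,0), (0,−1,0,0,0,0). Then H⁶ = −I₆ (so H¹² = I₆, and the image of H in PGL(6,ℂ) has order 6) and H⁻¹·T·H = T⁴. -/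
noncomputable section

open Complex

def Hmat : Matrix (Fin 6) (Fin 6) ℂ :=
  !![0, 0, 0, 0, 0, 1;
     0, 0, 0, 1, 0, 0;
     0, 0, 0, 0, 1, 0;
     0, 0, -1, 0, 0, 0;
     -1, 0, 0, 0, 0, 0;
     0, -1, 0, 0, 0, 0]

theorem Hmat_pow_two : Hmat ^ 2 =
    !![0, -1, 0, 0, 0, 0;
       0, 0, -1, 0, 0, 0;
       -1, 0, 0, 0, 0, 0;
       0, 0, 0, 0, -1, 0;
       0, 0, 0, 0, 0, -1;
       0, 0, 0, -1, 0, 0] := by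
  rw [pow_two]
  ext i j
  fin_cases i <;> fin_cases j <;> simp [Hmat, Matrix.mul_apply, Fin.sum_univ_six]

theorem Hmat_pow_six : Hmat ^ 6 = -1 := by
  rw [pow_mul Hmat 2 3, Hmat_pow_two, pow_three]
  ext i j
  fin_cases i <;> fin_cases j <;> simp [Matrix.mul_apply, Fin.sum_univ_six]

/-- The intertwining relation behind the conjugation formula `H⁻¹ T H = T⁴`. -/
theorem Tmat_mul_Hmat : Tmat * Hmat = Hmat * Tmat ^ 4 := by
  have h := zeta_pow_thirteen
  rw [Tmat, Matrix.diagonal_pow]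
  ext i j
  rw [Matrix.diagonal_mul, Matrix.mul_diagonal]
  fin_cases i <;> fin_cases j <;> simp [Hmat] <;> grind

theorem stmt4 : Hmat ^ 6 = -1 ∧ Hmat ^ 12 = 1 ∧ Hmat⁻¹ * Tmat * Hmat = Tmat ^ 4 := by
  have hunit : IsUnit Hmat.det := by
    rw [← Matrix.isUnit_iff_isUnit_det, ← isUnit_pow_iff (n := 6) (by norm_num), Hmat_pow_six]
    exact isUnit_one.neg
  refine ⟨Hmat_pow_six, ?_, ?_⟩
  · rw [pow_mul Hmat 6 2, Hmat_pow_six, neg_one_sq]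
  · rw [mul_assoc, Tmat_mul_Hmat, Matrix.nonsing_inv_mul_cancel_left _ _ hunit]
end
end

section
/- Let H be the 6×6 matrix whose rows are (0,0,0,0,0,1), (0,0,0,1,0,0), (0,0,0,0,1,0), (0,0,−1,0,0,0), (−1,0,0,0,0,0), (0,−1,0,0,0,0). For every v ∈ ℂ⁶ one has 𝔾₀(H·v) = 𝔾₀(v) and 𝔾₀(T·v) = 𝔾₀(v); that is, the sextic form 𝔾₀ is invariant under the subgroup of GL(6,ℂ) generated by H and T. -/
noncomputable section

open Complex

def DD0 (v : Fin 6 → ℂ) : ℂ := v 0 * v 1 * v 2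
def DDinf (v : Fin 6 → ℂ) : ℂ := v 3 * v 4 * v 5
def GG0 (v : Fin 6 → ℂ) : ℂ := (DD0 v) ^ 2 + (DDinf v) ^ 2

theorem stmt6 (v : Fin 6 → ℂ) :
    GG0 (Matrix.mulVec Hmat v) = GG0 v ∧ GG0 (Matrix.mulVec Tmat v) = GG0 v := by
  refine ⟨?_, ?_⟩
  · simp only [GG0, DD0, DDinf, Hmat, Matrix.mulVec, dotProduct, Fin.sum_univ_six]
    simp
    ring
  · have h₀ : DD0 (Matrix.mulVec Tmat v) = (ζ ^ 13) ^ 2 * DD0 v := by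
      simp [DD0, Tmat, Matrix.mulVec_diagonal]
      ring
    have hinf : DDinf (Matrix.mulVec Tmat v) = ζ ^ 13 * DDinf v := by
      simp [DDinf, Tmat, Matrix.mulVec_diagonal]
      ring
    simp only [GG0, h₀, hinf, zeta_pow_thirteen, one_pow, one_mul]
end
end

section
/- Let A(z) = (a₁(z), ..., a₆(z))ᵀ ∈ ℂ⁶ be the column vector of theta constants of order 13. For every z in the upper half-plane ℍ one has A(z+1) = e^{−3πi/4}·T·A(z) and A(−1/z) = e^{πi/4}·√z·S·A(z), where √z is the principal square root (the branch with 0 < arg √z ≤ π/2). -/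
noncomputable section

open Complex

def th13 (c : ℚ) (k : ℤ) (z : ℂ) : ℂ :=
  Complex.exp (2 * Real.pi * Complex.I * (c : ℂ) * z) *
    ∑' n : ℤ, (-1 : ℂ) ^ n *
      Complex.exp (2 * Real.pi * Complex.I * (((13 * n ^ 2 + k * n : ℤ) : ℂ) / 2) * z)

def ta : Fin 6 → ℂ → ℂ :=
  ![th13 (121 / 104) 11, th13 (49 / 104) 7, th13 (25 / 104) 5,
    fun z => -th13 (9 / 104) 3 z, th13 (81 / 104) 9, th13 (1 / 104) 1]

def AV (z : ℂ) : Fin 6 → ℂ := fun i => ta i z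

/-- The theta series `∑ (-1)ⁿ q^((26n+l)²/104)`. -/
def oddTheta (l : ℤ) (z : ℂ) : ℂ :=
  ∑' n : ℤ, (-1 : ℂ) ^ n * exp (Real.pi * I * ((26 * n + l : ℤ) : ℂ) ^ 2 / 52 * z)

lemma th13_eq_oddTheta (c : ℚ) (k : ℤ) (hc : c = (k : ℚ) ^ 2 / 104) (z : ℂ) :
    th13 c k z = oddTheta k z := by
  unfold th13 oddTheta
  rw [← tsum_mul_left]
  congr 1 with n
  rw [mul_left_comm, ← Complex.exp_add]
  congr 2
  subst hc
  push_cast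
  ring

lemma oddTheta_neg (l : ℤ) (z : ℂ) : oddTheta (-l) z = oddTheta l z := by
  unfold oddTheta
  rw [← (Equiv.neg ℤ).tsum_eq]
  congr 1 with n
  congr 1
  · simp [zpow_neg, ← inv_zpow]
  · congr 1
    simp only [Equiv.neg_apply]
    push_cast
    ring

lemma oddTheta_add (l : ℤ) (z : ℂ) : oddTheta (l + 26) z = -oddTheta l z := by
  unfold oddTheta
  rw [← (Equiv.addRight (-1 : ℤ)).tsum_eq, ← tsum_neg]
  congr 1 with n
  rw [Equiv.coe_addRight, zpow_add₀ (by norm_num), mul_assoc, ← neg_one_mul, ← mul_assoc,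
    mul_comm (-1 : ℂ), mul_assoc]
  norm_num
  left
  ring_nf

lemma oddTheta_reflect (l : ℤ) (z : ℂ) : oddTheta (26 - l) z = -oddTheta l z := by
  rw [show 26 - l = -l + 26 by ring, oddTheta_add, oddTheta_neg]

lemma oddTheta_add_one (l : ℤ) (hl : Odd l) (z : ℂ) :
    oddTheta l (z + 1) = exp (Real.pi * I * l ^ 2 / 52) * oddTheta l z := by
  unfold oddTheta
  rw [← tsum_mul_left]
  congr 1 with n
  rw [mul_left_comm, ← Complex.exp_add]
  congr 1
  rw [Complex.exp_eq_exp_iff_exists_int]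
  have h : Even (13 * n ^ 2 + l * n) := by
    rw [show 13 * n ^ 2 + l * n = n * (13 * n + l) by ring]
    rcases Int.even_or_odd n with hn | hn
    · exact hn.mul_right _
    · exact ((Odd.mul (by decide) hn).add_odd hl).mul_left _
  obtain ⟨m, hm⟩ := h
  refine ⟨m, ?_⟩
  have hm' : (13 * n ^ 2 + l * n : ℂ) = m + m := by exact_mod_cast hm
  push_cast
  linear_combination Real.pi * I * hm'

lemma tsum_int_eq_sum_fin (f : ℤ → ℂ) (N : ℕ) [NeZero N] (hf : Summable f) :
    ∑' m, f m = ∑ j : Fin N, ∑' n : ℤ, f (n * N + (j : ℕ)) := by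
  have hs := (Int.divModEquiv N).symm.summable_iff.mpr hf
  rw [← (Int.divModEquiv N).symm.tsum_eq]
  refine hs.tsum_prod.trans ?_
  simp only [tsum_fintype]
  rw [Summable.tsum_finsetSum]
  · rfl
  · intro j _
    exact hs.comp_injective (i := fun n : ℤ => (n, j)) (Prod.mk_left_injective j)

lemma neg_one_zpow_eq_exp (n : ℤ) : (-1 : ℂ) ^ n = exp (n * (Real.pi * I)) := by
  rw [Complex.exp_int_mul, Complex.exp_pi_mul_I]

lemma oddTheta_neg_inv (k : ℤ) (hk : Odd k) (z : ℂ) (hz : 0 < z.im) :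
    oddTheta k (-1 / z) = 1 / (-I * (-13 / z)) ^ (1 / 2 : ℂ) *
      ∑ j : Fin 13, exp (Real.pi * I / 26) ^ (k * (2 * (j : ℕ) + 1)) *
        oddTheta (2 * (j : ℕ) + 1) z := by
  have hz0 : z ≠ 0 := by rintro rfl; simp at hz
  have hz13 : 0 < (z / 13).im := by
    rw [show z / 13 = z / ((13 : ℝ) : ℂ) by norm_num, div_ofReal_im]
    positivity
  have h1 : oddTheta k (-1 / z) = exp (-(Real.pi * I * k ^ 2 / (52 * z))) *
      jacobiTheta₂ (1 / 2 - k / (2 * z)) (-13 / z) := by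
    unfold oddTheta jacobiTheta₂ jacobiTheta₂_term
    rw [← tsum_mul_left]
    congr 1 with n
    rw [neg_one_zpow_eq_exp, ← Complex.exp_add, ← Complex.exp_add]
    congr 1
    push_cast
    field_simp
    ring
  have hs : Summable fun m : ℤ =>
      exp (Real.pi * I / 26) ^ (k * (2 * m + 1)) *
        exp (Real.pi * I * (2 * m + 1) ^ 2 / 52 * z) := by
    have := ((summable_jacobiTheta₂_term_iff ((z + k) / 26) (z / 13)).mpr hz13).mul_left
      (exp (Real.pi * I * (z / 52 + k / 26)))
    refine this.congr fun m => ?_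
    unfold jacobiTheta₂_term
    rw [← Complex.exp_int_mul, ← Complex.exp_add, ← Complex.exp_add]
    congr 1
    push_cast
    ring
  rw [h1, jacobiTheta₂_functional_equation, mul_assoc (1 / _), mul_left_comm]
  congr 1
  trans ∑' m : ℤ, exp (Real.pi * I / 26) ^ (k * (2 * m + 1)) *
        exp (Real.pi * I * (2 * m + 1) ^ 2 / 52 * z)
  · unfold jacobiTheta₂ jacobiTheta₂_term
    rw [← (Equiv.addRight (1 : ℤ)).tsum_eq, ← tsum_mul_left, ← tsum_mul_left]
    congr 1 with m
    rw [← Complex.exp_int_mul, ← Complex.exp_add, ← Complex.exp_add, ← Complex.exp_add]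
    congr 1
    rw [Equiv.coe_addRight]
    push_cast
    field_simp
    ring
  · rw [tsum_int_eq_sum_fin _ 13 hs]
    refine Finset.sum_congr rfl fun j _ => ?_
    unfold oddTheta
    rw [← tsum_mul_left]
    congr 1 with n
    obtain ⟨c, rfl⟩ := hk
    rw [neg_one_zpow_eq_exp, ← Complex.exp_int_mul, ← Complex.exp_int_mul,
      ← Complex.exp_add, ← Complex.exp_add, ← Complex.exp_add, Complex.exp_eq_exp_iff_exists_int]
    refine ⟨c * n, ?_⟩
    push_cast
    ring

lemma one_div_cpow_half (z : ℂ) (hz : 0 < z.im) :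
    I * (1 / (-I * (-13 / z)) ^ (1 / 2 : ℂ)) =
      exp (Real.pi * I / 4) * z ^ (1 / 2 : ℂ) / (Real.sqrt 13 : ℂ) := by
  obtain ⟨w, rfl⟩ : ∃ w, z = I * w := ⟨-I * z, by linear_combination z * I_mul_I⟩
  have hw : 0 < w.re := by simpa using hz
  have hw0 : w ≠ 0 := by rintro rfl; simp at hw
  have harg := abs_lt.mp (Complex.abs_arg_lt_pi_div_two_iff.mpr (Or.inl hw))
  have hpi := Real.pi_pos
  have h1 : (I * w) ^ (1 / 2 : ℂ) = exp (Real.pi * I / 4) * w ^ (1 / 2 : ℂ) := by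
    rw [Complex.cpow_def_of_ne_zero (mul_ne_zero I_ne_zero hw0), Complex.cpow_def_of_ne_zero hw0,
      Complex.log_mul I_ne_zero hw0, Complex.log_I, ← Complex.exp_add]
    · congr 1
      ring
    · rw [Complex.arg_I]
      constructor <;> linarith
  have h2 : -I * (-13 / (I * w)) = ((13 : ℝ) : ℂ) * w⁻¹ := by
    field_simp
    norm_num
  have h3 : ((13 : ℝ) : ℂ) ^ (1 / 2 : ℂ) = (Real.sqrt 13 : ℂ) := by
    rw [Real.sqrt_eq_rpow, Complex.ofReal_cpow (by norm_num)]
    norm_num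
  have h4 : exp (Real.pi * I / 4) * exp (Real.pi * I / 4) = I := by
    rw [← Complex.exp_add]
    convert Complex.exp_pi_div_two_mul_I using 2
    ring
  have hwc : w ^ (1 / 2 : ℂ) ≠ 0 := by simp [Complex.cpow_eq_zero_iff, hw0]
  have h5 : (((13 : ℝ) : ℂ) * w⁻¹) ^ (1 / 2 : ℂ) = (Real.sqrt 13 : ℂ) * (w ^ (1 / 2 : ℂ))⁻¹ := by
    rw [← h3, ← Complex.inv_cpow _ _ (by linarith [harg.2])]
    rw [Complex.cpow_def_of_ne_zero (by simp [hw0]), Complex.cpow_def_of_ne_zero (by norm_num),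
      Complex.cpow_def_of_ne_zero (inv_ne_zero hw0),
      Complex.log_ofReal_mul (by norm_num) (inv_ne_zero hw0), Complex.ofReal_log (by norm_num),
      add_mul, Complex.exp_add]
  rw [h1, h2, h5, ← mul_assoc, h4]
  field_simp

lemma oddTheta_neg_inv_eq (k : ℕ) (hk : Odd k) (z : ℂ) (hz : 0 < z.im) :
    oddTheta k (-1 / z) = exp (Real.pi * I / 4) * z ^ (1 / 2 : ℂ) * (-(1 / (Real.sqrt 13 : ℂ)) *
      ∑ j : Fin 6, (exp (Real.pi * I / 26) ^ (13 + k * (2 * (j : ℕ) + 1)) -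
        exp (Real.pi * I / 26) ^ (13 + k * (25 - 2 * (j : ℕ)))) * oddTheta (2 * (j : ℕ) + 1) z) := by
  have hI : exp (Real.pi * I / 26) ^ 13 = I := by
    rw [← Complex.exp_nat_mul]
    convert Complex.exp_pi_div_two_mul_I using 2
    push_cast
    ring
  have hC := one_div_cpow_half z hz
  rw [oddTheta_neg_inv k (by exact_mod_cast hk) z hz]
  have hC' : 1 / (-I * (-13 / z)) ^ (1 / 2 : ℂ) =
      exp (Real.pi * I / 4) * z ^ (1 / 2 : ℂ) * (-(1 / (Real.sqrt 13 : ℂ)) * I) := by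
    linear_combination -I * hC + 1 / (-I * (-13 / z)) ^ (1 / 2 : ℂ) * I_mul_I
  have hsum : ∑ j : Fin 13, exp (Real.pi * I / 26) ^ ((k : ℤ) * (2 * (j : ℕ) + 1)) *
        oddTheta (2 * (j : ℕ) + 1) z =
      ∑ j : Fin 6, (exp (Real.pi * I / 26) ^ (k * (2 * (j : ℕ) + 1)) -
        exp (Real.pi * I / 26) ^ (k * (25 - 2 * (j : ℕ)))) * oddTheta (2 * (j : ℕ) + 1) z := by
    have e (j : ℕ) : exp (Real.pi * I / 26) ^ ((k : ℤ) * (2 * j + 1)) =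
        exp (Real.pi * I / 26) ^ (k * (2 * j + 1)) := by
      exact_mod_cast zpow_natCast (exp (Real.pi * I / 26)) (k * (2 * j + 1))
    have h13 : oddTheta 13 z = 0 := self_eq_neg.mp (oddTheta_reflect 13 z)
    have h15 : oddTheta 15 z = -oddTheta 11 z := oddTheta_reflect 11 z
    have h17 : oddTheta 17 z = -oddTheta 9 z := oddTheta_reflect 9 z
    have h19 : oddTheta 19 z = -oddTheta 7 z := oddTheta_reflect 7 z
    have h21 : oddTheta 21 z = -oddTheta 5 z := oddTheta_reflect 5 z
    have h23 : oddTheta 23 z = -oddTheta 3 z := oddTheta_reflect 3 z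
    have h25 : oddTheta 25 z = -oddTheta 1 z := oddTheta_reflect 1 z
    simp only [e]
    simp [Fin.sum_univ_succ, h13, h15, h17, h19, h21, h23, h25]
    ring
  simp only [pow_add _ 13, hI, ← mul_sub, mul_assoc I, ← Finset.mul_sum]
  rw [hC', hsum]
  ring

theorem stmt7 (z : ℂ) (hz : 0 < z.im) :
    (AV (z + 1) = fun i => Complex.exp (-(3 * Real.pi * Complex.I) / 4) * Matrix.mulVec Tmat (AV z) i) ∧
    (AV (-1 / z) = fun i =>
      Complex.exp (Real.pi * Complex.I / 4) * z ^ (1 / 2 : ℂ) * Matrix.mulVec Smat (AV z) i) := by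
  have ht : AV = fun z => ![oddTheta 11 z, oddTheta 7 z, oddTheta 5 z, -oddTheta 3 z,
      oddTheta 9 z, oddTheta 1 z] := by
    funext z i
    fin_cases i <;> simp [AV, ta] <;> refine th13_eq_oddTheta _ _ ?_ z <;> norm_num
  constructor
  · have phase (l m : ℤ) (e : ℕ) (h : (l : ℂ) ^ 2 + 39 - 8 * e = 104 * m) :
        exp (Real.pi * I * l ^ 2 / 52) = exp (-(3 * Real.pi * I) / 4) * ζ ^ e := by
      rw [ζ, ← Complex.exp_nat_mul, ← Complex.exp_add, Complex.exp_eq_exp_iff_exists_int]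
      exact ⟨m, by linear_combination Real.pi * I / 52 * h⟩
    rw [ht]
    funext i
    rw [Tmat, Matrix.mulVec_diagonal, ← mul_assoc]
    fin_cases i <;> dsimp
    · rw [oddTheta_add_one 11 (by decide), phase 11 1 7 (by norm_num)]
    · rw [oddTheta_add_one 7 (by decide), phase 7 0 11 (by norm_num)]
    · rw [oddTheta_add_one 5 (by decide), phase 5 0 8 (by norm_num)]
    · rw [oddTheta_add_one 3 (by decide), phase 3 0 6 (by norm_num), mul_neg]
    · rw [oddTheta_add_one 9 (by decide), phase 9 1 2 (by norm_num)]
    · rw [oddTheta_add_one 1 (by decide), phase 1 0 5 (by norm_num)]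
  · have hζ : ζ = exp (Real.pi * I / 26) ^ 4 := by
      rw [ζ, ← Complex.exp_nat_mul]
      congr 1
      push_cast
      ring
    have hω : exp (Real.pi * I / 26) ^ 26 = -1 := by
      rw [← Complex.exp_nat_mul, ← Complex.exp_pi_mul_I]
      congr 1
      push_cast
      ring
    have hS (k : ℕ) (hk : Odd k) := oddTheta_neg_inv_eq k hk z hz
    have h1 := hS 1 (by decide)
    have h3 := hS 3 (by decide)
    have h5 := hS 5 (by decide)
    have h7 := hS 7 (by decide)
    have h9 := hS 9 (by decide)
    have h11 := hS 11 (by decide)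
    rw [ht]
    funext i
    rw [Smat, Matrix.smul_mulVec, hζ]
    generalize exp (Real.pi * I / 26) = ω at *
    simp [Fin.sum_univ_succ] at h1 h3 h5 h7 h9 h11
    fin_cases i <;> simp [← pow_mul]
    on_goal 1 => rw [h11]
    on_goal 2 => rw [h7]
    on_goal 3 => rw [h5]
    on_goal 4 => rw [h3]
    on_goal 5 => rw [h9]
    on_goal 6 => rw [h1]
    all_goals
      generalize exp (Real.pi * I / 4) * z ^ (2⁻¹ : ℂ) = C
      generalize (Real.sqrt 13 : ℂ)⁻¹ = D
      clear * - hω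
      grind
end
end

section
/- For every γ = (a b; c d) ∈ SL(2, ℤ) with a ≡ d ≡ 1 (mod 13) and b ≡ c ≡ 0 (mod 13), there exists v ∈ ℂ with v⁴ = 1 such that for every i ∈ {1,...,6} and every z in the upper half-plane ℍ, y_i((az+b)/(cz+d)) = v·(cz+d)²·y_i(z). In other words, y₁, ..., y₆ are modular forms of weight 2 for the principal congruence subgroup Γ(13), all with the same fourth-root-of-unity multiplier. -/
noncomputable section

open Complex

def etaF (z : ℂ) : ℂ :=
  Complex.exp (2 * Real.pi * Complex.I * z / 24) *
    ∏' n : ℕ, (1 - Complex.exp (2 * Real.pi * Complex.I * z) ^ (n + 1))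

def yV (z : ℂ) : Fin 6 → ℂ := fun i => (etaF z) ^ 3 * ta i z

open UpperHalfPlane hiding I

open ModularGroup (S T)

open scoped Real MatrixGroups ModularForm

/-- The theta function with characteristic `φ_{u,v}(τ) = i exp(πi u(uτ+v)) θ₁(uτ+v | τ)`. -/
def charTheta (u v τ : ℂ) : ℂ :=
  Complex.exp (π * I * ((u + 1 / 2) ^ 2 * τ + u * v + v)) *
    jacobiTheta₂ (u * τ + v + 1 / 2 + τ / 2) τ

lemma jacobiTheta₂_add_one_right (z τ : ℂ) :
    jacobiTheta₂ z (τ + 1) = jacobiTheta₂ (z + 1 / 2) τ := by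
  refine tsum_congr fun n ↦ ?_
  obtain ⟨k, hk⟩ : Even (n * (n - 1)) := Int.even_mul_pred_self n
  have hk' : (n : ℂ) * (n - 1) = k + k := by exact_mod_cast hk
  rw [jacobiTheta₂_term, jacobiTheta₂_term, Complex.exp_eq_exp_iff_exists_int]
  refine ⟨k, ?_⟩
  linear_combination (π * I) * hk'

lemma charTheta_add_one_left (u v τ : ℂ) :
    charTheta (u + 1) v τ = -Complex.exp (-π * I * v) * charTheta u v τ := by
  have e : (u + 1) * τ + v + 1 / 2 + τ / 2 = (u * τ + v + 1 / 2 + τ / 2) + τ := by ring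
  rw [charTheta, charTheta, e, jacobiTheta₂_add_left', neg_mul, ← mul_assoc, ← mul_assoc,
    ← neg_mul, ← Complex.exp_add]
  congr 1
  rw [← neg_one_mul (Complex.exp _), ← Complex.exp_pi_mul_I, ← Complex.exp_add,
    ← Complex.exp_add, Complex.exp_eq_exp_iff_exists_int]
  exact ⟨-1, by push_cast; ring⟩

lemma charTheta_add_one_right (u v τ : ℂ) :
    charTheta u (v + 1) τ = -Complex.exp (π * I * u) * charTheta u v τ := by
  have e : u * τ + (v + 1) + 1 / 2 + τ / 2 = (u * τ + v + 1 / 2 + τ / 2) + 1 := by ring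
  rw [charTheta, charTheta, e, jacobiTheta₂_add_left, ← mul_assoc, neg_mul, ← Complex.exp_add]
  congr 1
  rw [← neg_one_mul (Complex.exp _), ← Complex.exp_pi_mul_I, ← Complex.exp_add]
  congr 1
  ring

lemma charTheta_add_int_left (u v τ : ℂ) (r : ℤ) :
    charTheta (u + r) v τ = Complex.exp (π * I * (r * (1 - v))) * charTheta u v τ := by
  have key (w : ℂ) : charTheta (w + 1) v τ = Complex.exp (π * I * (1 - v)) * charTheta w v τ := by
    rw [charTheta_add_one_left, mul_sub, sub_eq_add_neg, Complex.exp_add]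
    simp
  induction r with
  | zero => simp
  | succ i ih =>
    push_cast at ih ⊢
    rw [← add_assoc, key, ih, ← mul_assoc, ← Complex.exp_add]
    ring_nf
  | pred i ih =>
    have h := key (u + (-(i : ℂ) - 1))
    rw [show u + (-(i : ℂ) - 1) + 1 = u + -i by ring] at h
    push_cast at ih ⊢
    rw [ih] at h
    rw [sub_mul, mul_sub, sub_eq_add_neg (π * I * _), Complex.exp_add, mul_right_comm, h,
      one_mul, mul_right_comm, ← Complex.exp_add, add_neg_cancel, Complex.exp_zero, one_mul]

lemma charTheta_add_int_right (u v τ : ℂ) (r : ℤ) :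
    charTheta u (v + r) τ = Complex.exp (π * I * (r * (1 + u))) * charTheta u v τ := by
  have key (w : ℂ) : charTheta u (w + 1) τ = Complex.exp (π * I * (1 + u)) * charTheta u w τ := by
    rw [charTheta_add_one_right, mul_add, Complex.exp_add]
    simp
  induction r with
  | zero => simp
  | succ i ih =>
    push_cast at ih ⊢
    rw [← add_assoc, key, ih, ← mul_assoc, ← Complex.exp_add]
    ring_nf
  | pred i ih =>
    have h := key (v + (-(i : ℂ) - 1))
    rw [show v + (-(i : ℂ) - 1) + 1 = v + -i by ring] at h
    push_cast at ih ⊢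
    rw [ih] at h
    rw [sub_mul, mul_sub, sub_eq_add_neg (π * I * _), Complex.exp_add, mul_right_comm, h,
      one_mul, mul_right_comm, ← Complex.exp_add, add_neg_cancel, Complex.exp_zero, one_mul]

lemma charTheta_add_one (u v τ : ℂ) :
    charTheta u v (τ + 1) = Complex.exp (π * I / 4) * charTheta u (u + v) τ := by
  have e : u * (τ + 1) + v + 1 / 2 + (τ + 1) / 2 + 1 / 2 =
    (u * τ + (u + v) + 1 / 2 + τ / 2) + 1 := by ring
  rw [charTheta, charTheta, jacobiTheta₂_add_one_right, e, jacobiTheta₂_add_left, ← mul_assoc,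
    ← Complex.exp_add]
  congr 2
  ring

lemma charTheta_neg_one_div (u v : ℂ) {τ : ℂ} (hτ : τ ≠ 0) :
    charTheta u v (-1 / τ) = -I * (-I * τ) ^ (1 / 2 : ℂ) * charTheta v (-u) τ := by
  have hs : (-I * τ) ^ (1 / 2 : ℂ) ≠ 0 := by
    rw [Complex.cpow_ne_zero_iff]; simp [hτ]
  have e1 : u * (-1 / τ) + v + 1 / 2 + -1 / τ / 2 =
    (v * τ + -u + 1 / 2 + τ / 2) / τ + -1 / τ := by field_simp; ring
  rw [charTheta, charTheta, e1, jacobiTheta₂_add_left',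
    jacobiTheta₂_functional_equation (v * τ + -u + 1 / 2 + τ / 2) τ]
  have hI : -I = Complex.exp (π * I * (-1 / 2)) := by
    rw [show (π * I * (-1 / 2) : ℂ) = -(π / 2 * I) by ring, Complex.exp_neg,
      Complex.exp_pi_div_two_mul_I, Complex.inv_I]
  generalize (-I * τ) ^ (1 / 2 : ℂ) = s at hs
  rw [hI]
  generalize jacobiTheta₂ _ _ = w
  have : Complex.exp (π * I * ((u + 1 / 2) ^ 2 * (-1 / τ) + u * v + v)) *
      Complex.exp (-π * I * (-1 / τ + 2 * ((v * τ + -u + 1 / 2 + τ / 2) / τ))) =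
      Complex.exp (π * I * (-1 / 2)) * (Complex.exp (π * I * ((v + 1 / 2) ^ 2 * τ + v * -u + -u)) *
      Complex.exp (-π * I * (v * τ + -u + 1 / 2 + τ / 2) ^ 2 / τ)) := by
    rw [← Complex.exp_add, ← Complex.exp_add, ← Complex.exp_add]
    congr 1
    field_simp
    ring
  field_simp at this ⊢
  linear_combination w * this

lemma eta_add_one (τ : ℂ) : η (τ + 1) = Complex.exp (π * I / 12) * η τ := by
  have h (n : ℕ) : ModularForm.eta_q n (τ + 1) = ModularForm.eta_q n τ := by
    rw [ModularForm.eta_q_eq_pow, ModularForm.eta_q_eq_pow, mul_add, Complex.exp_add]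
    simp
  simp only [ModularForm.eta, h, Function.Periodic.qParam]
  rw [← mul_assoc, ← Complex.exp_add]
  congr 2
  push_cast
  ring

lemma eta_neg_one_div {τ : ℂ} (hτ : 0 < τ.im) :
    η (-1 / τ) = (-I * τ) ^ (1 / 2 : ℂ) * η τ := by
  have h := ModularForm.eta_comp_eq_csqrt_I_inv hτ
  simp only [Function.comp, Pi.smul_apply, Pi.mul_apply, smul_eq_mul] at h
  have h0 : τ ≠ 0 := by rintro rfl; simp at hτ
  have hre : 0 < (-I * τ).re := by simpa using hτ
  have hlog : Complex.log τ = Complex.log I + Complex.log (-I * τ) := by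
    rw [← Complex.log_mul I_ne_zero (by simp [h0])]
    · congr 1
      linear_combination τ * I_mul_I
    · have := abs_lt.1 (Complex.abs_arg_lt_pi_div_two_iff.2 (Or.inl hre))
      rw [Complex.arg_I]
      constructor <;> linarith
  rw [h, ← mul_assoc]
  congr 1
  rw [Complex.sqrt, Complex.sqrt, Complex.cpow_def_of_ne_zero h0,
    Complex.cpow_def_of_ne_zero I_ne_zero, Complex.cpow_def_of_ne_zero (by simp [h0]),
    ← Complex.exp_neg, ← Complex.exp_add, hlog]
  congr 1
  ring

/-- The sign character of `SL(2, ℤ/2) ≃ S₃`. -/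
def sl2Sign (g : SL(2, ZMod 2)) : ℤ :=
  if (1 + g 0 0 + g 1 1) * (1 + (1 + g 0 1) * (1 + g 1 0)) = 0 then 1 else -1

lemma sl2Sign_mul (g h : SL(2, ZMod 2)) : sl2Sign (g * h) = sl2Sign g * sl2Sign h := by
  revert g h
  decide

/-- The sign of an integral matrix modulo 2. -/
def sl2zSign (γ : SL(2, ℤ)) : ℂ :=
  (sl2Sign (Matrix.SpecialLinearGroup.map (Int.castRingHom (ZMod 2)) γ) : ℤ)

lemma sl2zSign_eq (γ : SL(2, ℤ)) : sl2zSign γ =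
    ((if (1 + (γ 0 0 : ZMod 2) + γ 1 1) * (1 + (1 + (γ 0 1 : ZMod 2)) * (1 + γ 1 0)) = 0
      then 1 else -1 : ℤ) : ℂ) := rfl

lemma sl2zSign_mul (g h : SL(2, ℤ)) : sl2zSign (g * h) = sl2zSign g * sl2zSign h := by
  simp [sl2zSign, sl2Sign_mul]

lemma sl2zSign_mul_self (g : SL(2, ℤ)) : sl2zSign g * sl2zSign g = 1 := by
  rw [sl2zSign, sl2Sign]
  split_ifs <;> simp

/-- `charTheta` and `η³` transform under `γ` with the same multiplier, and `η¹²` transforms with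
the sign character. -/
structure ThetaEtaTransform (γ : SL(2, ℤ)) : Prop where
  theta (u v : ℂ) (τ : ℍ) : charTheta u v (γ • τ : ℍ) * (denom γ τ * η τ ^ 3) =
    η (γ • τ : ℍ) ^ 3 * charTheta (u * γ 0 0 + v * γ 1 0) (u * γ 0 1 + v * γ 1 1) τ
  eta_pow (τ : ℍ) : η (γ • τ : ℍ) ^ 12 = sl2zSign γ * denom γ τ ^ 6 * η τ ^ 12

lemma thetaEtaTransform_T : ThetaEtaTransform T where
  theta u v τ := by
    have hT : ((T • τ : ℍ) : ℂ) = τ + 1 := by rw [modular_T_smul, coe_vadd]; push_cast; ring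
    have hd : denom T τ = 1 := by rw [ModularGroup.denom_apply]; simp [ModularGroup.T]
    rw [hT, hd, charTheta_add_one, eta_add_one, mul_pow, ← Complex.exp_nat_mul]
    simp only [ModularGroup.T]
    simp
    rw [show (3 * (π * I / 12) : ℂ) = π * I / 4 by ring]
    ring
  eta_pow τ := by
    have hT : ((T • τ : ℍ) : ℂ) = τ + 1 := by rw [modular_T_smul, coe_vadd]; push_cast; ring
    have hd : denom T τ = 1 := by rw [ModularGroup.denom_apply]; simp [ModularGroup.T]
    have hs : sl2zSign T = -1 := by
      have : sl2Sign (Matrix.SpecialLinearGroup.map (Int.castRingHom (ZMod 2)) T) = -1 := by decide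
      rw [sl2zSign, this]; simp
    rw [hT, hd, eta_add_one, mul_pow, ← Complex.exp_nat_mul, hs,
      show ((12 : ℕ) * (π * I / 12) : ℂ) = π * I by push_cast; ring, Complex.exp_pi_mul_I]
    ring

lemma thetaEtaTransform_S : ThetaEtaTransform S where
  theta u v τ := by
    have hS : ((S • τ : ℍ) : ℂ) = -1 / τ := by
      rw [modular_S_smul]; simp [neg_div]
    have hd := ModularGroup.denom_S τ
    have hsq : ((-I * (τ : ℂ)) ^ (1 / 2 : ℂ)) ^ 2 = -I * τ := by
      rw [← Complex.cpow_nat_mul]; simp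
    rw [hS, hd, charTheta_neg_one_div u v τ.ne_zero, eta_neg_one_div τ.im_pos]
    simp only [ModularGroup.S]
    simp
    simp only [one_div, neg_mul] at hsq
    linear_combination (-(-(I * (τ : ℂ))) ^ (2⁻¹ : ℂ) * η τ ^ 3 * charTheta v (-u) τ) * hsq
  eta_pow τ := by
    have hS : ((S • τ : ℍ) : ℂ) = -1 / τ := by
      rw [modular_S_smul]; simp [neg_div]
    have hd := ModularGroup.denom_S τ
    have hsq : ((-I * (τ : ℂ)) ^ (1 / 2 : ℂ)) ^ 2 = -I * τ := by
      rw [← Complex.cpow_nat_mul]; simp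
    have hs : sl2zSign S = -1 := by
      have : sl2Sign (Matrix.SpecialLinearGroup.map (Int.castRingHom (ZMod 2)) S) = -1 := by decide
      rw [sl2zSign, this]; simp
    rw [hS, hd, eta_neg_one_div τ.im_pos, hs, mul_pow, show 12 = 2 * 6 from rfl, pow_mul, hsq,
      mul_pow, neg_pow, show I ^ 6 = -1 by rw [show 6 = 2 * 3 from rfl, pow_mul, I_sq]; norm_num]
    ring

lemma denom_sl_mul (g h : SL(2, ℤ)) (τ : ℍ) :
    denom ((g * h : SL(2, ℤ)) : GL (Fin 2) ℝ) τ = denom g (h • τ : ℍ) * denom h τ := by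
  have h0 : (h 1 0 : ℂ) * τ + h 1 1 ≠ 0 := by
    rw [← ModularGroup.denom_apply]; exact denom_ne_zero h τ
  rw [ModularGroup.denom_apply, ModularGroup.denom_apply, ModularGroup.denom_apply,
    coe_specialLinearGroup_apply]
  simp [Matrix.mul_apply, Fin.sum_univ_two]
  field_simp
  ring

lemma ThetaEtaTransform.mul {g h : SL(2, ℤ)} (hg : ThetaEtaTransform g)
    (hh : ThetaEtaTransform h) : ThetaEtaTransform (g * h) where
  theta u v τ := by
    have h1 := hg.theta u v (h • τ)
    have h2 := hh.theta (u * g 0 0 + v * g 1 0) (u * g 0 1 + v * g 1 1) τ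
    have hd := denom_sl_mul g h τ
    have hη : η (h • τ : ℍ) ≠ 0 := ModularForm.eta_ne_zero (h • τ).im_pos
    have e1 : u * ((g * h) 0 0 : ℤ) + v * ((g * h) 1 0 : ℤ) =
      (u * g 0 0 + v * g 1 0) * h 0 0 + (u * g 0 1 + v * g 1 1) * h 1 0 := by
      simp [Matrix.mul_apply, Fin.sum_univ_two]; ring
    have e2 : u * ((g * h) 0 1 : ℤ) + v * ((g * h) 1 1 : ℤ) =
      (u * g 0 0 + v * g 1 0) * h 0 1 + (u * g 0 1 + v * g 1 1) * h 1 1 := by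
      simp [Matrix.mul_apply, Fin.sum_univ_two]; ring
    rw [e1, e2, hd, mul_smul]
    apply mul_right_cancel₀ (pow_ne_zero 3 hη)
    linear_combination denom h τ * η τ ^ 3 * h1 + η (g • h • τ : ℍ) ^ 3 * h2
  eta_pow τ := by
    have hd := denom_sl_mul g h τ
    rw [mul_smul, hg.eta_pow, hh.eta_pow, sl2zSign_mul, hd]
    ring

lemma thetaEtaTransform_one : ThetaEtaTransform 1 where
  theta u v τ := by simp; ring
  eta_pow τ := by
    have : sl2zSign 1 = 1 := by
      have h : sl2Sign 1 = 1 := by decide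
      simp [sl2zSign, h]
    simp [this]

lemma ThetaEtaTransform.inv {g : SL(2, ℤ)} (hg : ThetaEtaTransform g) :
    ThetaEtaTransform g⁻¹ := by
  have hd (τ : ℍ) : denom g (g⁻¹ • τ : ℍ) * denom ((g⁻¹ : SL(2, ℤ)) : GL (Fin 2) ℝ) τ = 1 := by
    have := denom_sl_mul g g⁻¹ τ
    rwa [mul_inv_cancel, map_one, map_one, denom_one, eq_comm] at this
  have hdet : (g 0 0 : ℂ) * g 1 1 - g 0 1 * g 1 0 = 1 := by
    exact_mod_cast (Matrix.det_fin_two g.1).symm.trans g.2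
  constructor
  · intro u v τ
    have h1 := hg.theta (u * g 1 1 - v * g 1 0) (-u * g 0 1 + v * g 0 0) (g⁻¹ • τ)
    rw [smul_inv_smul] at h1
    have e1 : (u * g 1 1 - v * g 1 0) * g 0 0 + (-u * g 0 1 + v * g 0 0) * g 1 0 = u := by
      linear_combination u * hdet
    have e2 : (u * g 1 1 - v * g 1 0) * g 0 1 + (-u * g 0 1 + v * g 0 0) * g 1 1 = v := by
      linear_combination v * hdet
    rw [e1, e2] at h1
    have e3 : u * (g⁻¹ 0 0 : ℤ) + v * (g⁻¹ 1 0 : ℤ) = u * g 1 1 - v * g 1 0 := by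
      simp [Matrix.SpecialLinearGroup.SL2_inv_expl]; ring
    have e4 : u * (g⁻¹ 0 1 : ℤ) + v * (g⁻¹ 1 1 : ℤ) = -u * g 0 1 + v * g 0 0 := by
      simp [Matrix.SpecialLinearGroup.SL2_inv_expl]
    rw [e3, e4]
    linear_combination (-denom ((g⁻¹ : SL(2, ℤ)) : GL (Fin 2) ℝ) τ) * h1 +
      η (g⁻¹ • τ : ℍ) ^ 3 *
        charTheta (u * g 1 1 - v * g 1 0) (-u * g 0 1 + v * g 0 0) τ * hd τ
  · intro τ
    have h1 := hg.eta_pow (g⁻¹ • τ)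
    rw [smul_inv_smul] at h1
    have hs : sl2zSign g⁻¹ = sl2zSign g := by
      have h2 : sl2zSign g * sl2zSign g⁻¹ = 1 := by
        have h : sl2Sign 1 = 1 := by decide
        rw [← sl2zSign_mul, mul_inv_cancel]; simp [sl2zSign, h]
      linear_combination sl2zSign g * h2 - sl2zSign g⁻¹ * sl2zSign_mul_self g
    have h6 : denom g (g⁻¹ • τ : ℍ) ^ 6 * denom ((g⁻¹ : SL(2, ℤ)) : GL (Fin 2) ℝ) τ ^ 6 = 1 := by
      rw [← mul_pow, hd, one_pow]
    rw [hs, h1]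
    linear_combination (-η (g⁻¹ • τ : ℍ) ^ 12) * (h6 + denom g (g⁻¹ • τ : ℍ) ^ 6 *
      denom ((g⁻¹ : SL(2, ℤ)) : GL (Fin 2) ℝ) τ ^ 6 * sl2zSign_mul_self g)

theorem thetaEtaTransform (γ : SL(2, ℤ)) : ThetaEtaTransform γ := by
  have hγ : γ ∈ Subgroup.closure {S, T} := by simp [SpecialLinearGroup.SL2Z_generators]
  induction hγ using Subgroup.closure_induction with
  | mem x hx =>
    rcases hx with rfl | rfl
    exacts [thetaEtaTransform_S, thetaEtaTransform_T]
  | one => exact thetaEtaTransform_one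
  | mul x y _ _ hx hy => exact hx.mul hy
  | inv x _ hx => exact hx.inv

lemma charTheta_shift (m a b : ℤ) (τ : ℂ) (hab : Even (a * (1 + b))) :
    charTheta (m / 13 + m * a) (13 * m * b) τ = charTheta (m / 13) 0 τ := by
  have h1 := charTheta_add_int_left (m / 13) (13 * m * b) τ (m * a)
  have h2 := charTheta_add_int_right (m / 13) 0 τ (13 * m * b)
  push_cast at h1 h2
  rw [zero_add] at h2
  rw [h1, h2, ← mul_assoc, ← Complex.exp_add]
  obtain ⟨k, hk⟩ : Even (m * a - 13 * m ^ 2 * a * b + 13 * m * b + m ^ 2 * b) := by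
    have : ¬Even (13 : ℤ) := by decide
    have hb := Int.not_even_iff_odd (n := b)
    simp [parity_simps, this] at hab ⊢
    tauto
  have hk' : (m : ℂ) * a - 13 * m ^ 2 * a * b + 13 * m * b + m ^ 2 * b = k + k := by
    exact_mod_cast hk
  rw [show (π * I * (m * a * (1 - 13 * m * b)) + π * I * (13 * m * b * (1 + m / 13)) : ℂ) =
    k * (2 * π * I) by linear_combination π * I * hk', Complex.exp_int_mul_two_pi_mul_I, one_mul]

lemma th13_eq_charTheta (q : ℚ) (k m : ℤ) (hq : q = k ^ 2 / 104) (hk : k = 2 * m + 13) (z : ℂ) :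
    th13 q k z = charTheta (m / 13) 0 (13 * z) := by
  rw [th13, charTheta, jacobiTheta₂, hq, hk]
  congr 1
  · congr 1
    push_cast
    ring
  · refine tsum_congr fun n ↦ ?_
    rw [jacobiTheta₂_term, ← Complex.exp_pi_mul_I, ← Complex.exp_int_mul, ← Complex.exp_add]
    congr 1
    push_cast
    ring

lemma exists_ta_eq_charTheta (i : Fin 6) :
    ∃ (m : ℤ) (ε : ℂ), ∀ z, ta i z = ε * charTheta (m / 13) 0 (13 * z) := by
  have key (q : ℚ) (k m : ℤ) (hq : q = k ^ 2 / 104) (hk : k = 2 * m + 13) (ε : ℂ) :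
      ∃ (m : ℤ) (ε' : ℂ), ∀ z, ε * th13 q k z = ε' * charTheta (m / 13) 0 (13 * z) :=
    ⟨m, ε, fun z ↦ by rw [th13_eq_charTheta q k m hq hk]⟩
  fin_cases i
  · simpa [ta] using key (121 / 104) 11 (-1) (by norm_num) (by norm_num) 1
  · simpa [ta] using key (49 / 104) 7 (-3) (by norm_num) (by norm_num) 1
  · simpa [ta] using key (25 / 104) 5 (-4) (by norm_num) (by norm_num) 1
  · simpa [ta] using key (9 / 104) 3 (-5) (by norm_num) (by norm_num) (-1)
  · simpa [ta] using key (81 / 104) 9 (-2) (by norm_num) (by norm_num) 1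
  · simpa [ta] using key (1 / 104) 1 (-6) (by norm_num) (by norm_num) 1

lemma etaF_eq_eta (z : ℂ) : etaF z = η z := by
  simp only [etaF, ModularForm.eta, ModularForm.eta_q_eq_pow, Function.Periodic.qParam]
  norm_num

lemma continuous_eta_comp {g : ℍ → ℂ} (hg : Continuous g) (him : ∀ τ, 0 < (g τ).im) :
    Continuous fun τ ↦ η (g τ) :=
  continuous_iff_continuousAt.2 fun τ ↦
    (ModularForm.differentiableAt_eta_of_mem_upperHalfPlaneSet (him τ)).continuousAt.comp
      hg.continuousAt

/-- A continuous function on the upper half-plane with values in the fourth roots of unity is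
constant. -/
lemma exists_const_of_pow_four_eq_one {f : ℍ → ℂ} (hf : Continuous f) (h : ∀ τ, f τ ^ 4 = 1) :
    ∃ u : ℂ, u ^ 4 = 1 ∧ ∀ τ, f τ = u := by
  have hfin : {w : ℂ | w ^ 4 = 1}.Finite := by
    refine (Polynomial.nthRootsFinset 4 (1 : ℂ)).finite_toSet.subset fun w hw ↦ ?_
    simpa [Polynomial.mem_nthRootsFinset] using hw
  obtain ⟨u, hu, hfu⟩ := isPreconnected_univ.eqOn_const_of_mapsTo hfin.isDiscrete
    hf.continuousOn (fun τ _ ↦ h τ) ⟨1, by simp⟩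
  exact ⟨u, hu, fun τ ↦ hfu (Set.mem_univ τ)⟩

theorem stmt9 (a b c d : ℤ) (h : a * d - b * c = 1)
    (ha : a ≡ 1 [ZMOD 13]) (hd : d ≡ 1 [ZMOD 13])
    (hb : b ≡ 0 [ZMOD 13]) (hc : c ≡ 0 [ZMOD 13]) :
    ∃ u : ℂ, u ^ 4 = 1 ∧ ∀ (i : Fin 6) (z : ℂ), 0 < z.im →
      yV (((a : ℂ) * z + (b : ℂ)) / ((c : ℂ) * z + (d : ℂ))) i
        = u * ((c : ℂ) * z + (d : ℂ)) ^ 2 * yV z i := by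
  obtain ⟨a', ha'⟩ := ha.symm.dvd
  obtain ⟨b', rfl⟩ := Int.modEq_zero_iff_dvd.1 hb
  obtain ⟨c', rfl⟩ := Int.modEq_zero_iff_dvd.1 hc
  obtain rfl : a = 1 + 13 * a' := by linarith
  let γ : SL(2, ℤ) := ⟨!![1 + 13 * a', 13 * b'; 13 * c', d], by
    rw [Matrix.det_fin_two_of, h]⟩
  let γ' : SL(2, ℤ) := ⟨!![1 + 13 * a', 13 * (13 * b'); c', d], by
    rw [Matrix.det_fin_two_of]; linarith⟩
  have hpar : Even (a' * (1 + b')) := by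
    have h13 : ¬Even (13 : ℤ) := by decide
    have := congrArg Even h
    have hodd := Int.not_even_iff_odd (n := a')
    simp [parity_simps, h13] at this ⊢
    have hodd' := Int.not_even_iff_odd (n := b')
    tauto
  have hsign : sl2zSign γ' = sl2zSign γ := by
    have h13 : (13 : ZMod 2) = 1 := by decide
    rw [sl2zSign_eq, sl2zSign_eq]
    simp [γ, γ', h13]
  let σ (τ : ℍ) : ℍ := ⟨13 * τ, by simpa using τ.im_pos⟩
  have hσ (τ : ℍ) : (σ τ : ℂ) = 13 * τ := rfl
  have hγ (τ : ℍ) : ((γ • τ : ℍ) : ℂ) =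
      (((1 + 13 * a' : ℤ) : ℂ) * τ + (13 * b' : ℤ)) / (((13 * c' : ℤ) : ℂ) * τ + d) := by
    rw [coe_specialLinearGroup_apply]; simp [γ]
  have hden (τ : ℍ) : denom γ τ = ((13 * c' : ℤ) : ℂ) * τ + d := by
    rw [ModularGroup.denom_apply]; simp [γ]
  have hden' (τ : ℍ) : denom γ' (σ τ) = denom γ τ := by
    rw [hden, ModularGroup.denom_apply, hσ]; simp [γ']; ring
  have hγσ (τ : ℍ) : γ' • σ τ = σ (γ • τ) := by
    ext
    rw [hσ, hγ, coe_specialLinearGroup_apply, hσ]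
    simp [γ']
    ring
  have hη (τ : ℍ) : η τ ≠ 0 := ModularForm.eta_ne_zero τ.im_pos
  have hcont : Continuous fun τ : ℍ ↦ ((γ • τ : ℍ) : ℂ) :=
    continuous_coe.comp (continuous_const_smul (γ : GL (Fin 2) ℝ))
  let f (τ : ℍ) : ℂ := η (γ • τ : ℍ) ^ 3 * η (σ (γ • τ)) ^ 3 /
    (denom γ τ ^ 3 * (η τ ^ 3 * η (σ τ) ^ 3))
  have hf0 (τ : ℍ) :
      denom γ τ ^ 3 * (η τ ^ 3 * η (σ τ) ^ 3) ≠ 0 :=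
    mul_ne_zero (pow_ne_zero _ (denom_ne_zero _ _))
      (mul_ne_zero (pow_ne_zero _ (hη _)) (pow_ne_zero _ (hη _)))
  have hf : Continuous f := by
    refine Continuous.div (.mul (.pow ?_ 3) (.pow ?_ 3))
      (.mul (.pow ?_ 3) (.mul (.pow ?_ 3) (.pow ?_ 3))) hf0
    · exact continuous_eta_comp hcont fun τ ↦ (γ • τ).im_pos
    · exact continuous_eta_comp (continuous_const.mul hcont) fun τ ↦ (σ (γ • τ)).im_pos
    · simp only [hden]; fun_prop
    · exact continuous_eta_comp (by fun_prop) fun τ ↦ τ.im_pos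
    · exact continuous_eta_comp (by simp only [hσ]; fun_prop) fun τ ↦ (σ τ).im_pos
  have hf4 (τ : ℍ) : f τ ^ 4 = 1 := by
    have h1 := (thetaEtaTransform γ).eta_pow τ
    have h2 := (thetaEtaTransform γ').eta_pow (σ τ)
    rw [hγσ, hden', hsign] at h2
    rw [div_pow, div_eq_one_iff_eq (pow_ne_zero 4 (hf0 τ)), mul_pow, ← pow_mul, ← pow_mul, h1, h2]
    linear_combination denom γ τ ^ 12 * η τ ^ 12 * η (σ τ) ^ 12 *
      sl2zSign_mul_self γ
  obtain ⟨u, hu, hfu⟩ := exists_const_of_pow_four_eq_one hf hf4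
  refine ⟨u, hu, fun i z hz ↦ ?_⟩
  lift z to ℍ using hz
  obtain ⟨m, ε, hm⟩ := exists_ta_eq_charTheta i
  have hθ := (thetaEtaTransform γ').theta (m / 13) 0 (σ z)
  have e1 : (m / 13 : ℂ) * (γ' 0 0 : ℤ) + 0 * (γ' 1 0 : ℤ) = m / 13 + m * a' := by
    simp [γ']; ring
  have e2 : (m / 13 : ℂ) * (γ' 0 1 : ℤ) + 0 * (γ' 1 1 : ℤ) = 13 * m * b' := by
    simp [γ']; ring
  rw [e1, e2, charTheta_shift m a' b' _ hpar, hγσ, hden', hσ (γ • z)] at hθ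
  have hfz := hfu z
  rw [div_eq_iff (hf0 z)] at hfz
  rw [← hγ, ← hden, yV, yV, etaF_eq_eta, etaF_eq_eta, hm, hm, ← hσ z]
  apply mul_right_cancel₀ (mul_ne_zero (denom_ne_zero γ z) (pow_ne_zero 3 (hη (σ z))))
  rw [hσ (γ • z)] at hfz
  linear_combination η (γ • z : ℍ) ^ 3 * ε * hθ +
    ε * charTheta (m / 13) 0 (σ z) * hfz
end
end
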